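/- Let m,k be positive integers with (m+1) | k, and let D = (m^{↑k−1},m^{↑k−2},…,m^{↑0}), i.e., D = {(i,j) ∈ ℕ² : 0 ≤ i ≤ k−1, k−1−i ≤ j ≤ k+m−2−i}. Then the system L = L_D(m^{×2k/(m+1)}) is non-special and vdim L = −1. -/

import Mathlib

open MvPolynomial

/-- The differential operator `∂^{β₁}_X ∂^{β₂}_Y` on `K[X,Y]` (with `X` the variable `0`
and `Y` the variable `1`). -/
noncomputable def derivOp (K : Type*) [CommRing K] (β : ℕ × ℕ) :
    Module.End K (MvPolynomial (Fin 2) K) :=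
  ((pderiv (0 : Fin 2)).toLinearMap ^ β.1) * ((pderiv (1 : Fin 2)).toLinearMap ^ β.2)

/-- Evaluation of a polynomial in `K[X,Y]` at a point of `K²`, as a linear map. -/
noncomputable def evalPt (K : Type*) [CommRing K] (p : K × K) :
    MvPolynomial (Fin 2) K →ₗ[K] K :=
  (MvPolynomial.aeval (fun i : Fin 2 => if i = 0 then p.1 else p.2)).toLinearMap

/-- The space of polynomials whose monomial support is contained in the diagram `D`. -/
noncomputable def monoSpan (K : Type*) [Field K] (D : Finset (ℕ × ℕ)) :
    Submodule K (MvPolynomial (Fin 2) K) :=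
  Submodule.span K ((fun d : ℕ × ℕ =>
    (monomial (Finsupp.single (0 : Fin 2) d.1 + Finsupp.single 1 d.2) (1 : K))) '' D)

/-- `L_D(m₁p₁, …, m_rp_r)`: the space of polynomials supported on `D` whose partial
derivatives of total order `< m j` all vanish at the point `p j`, for `j = 1, …, r`. -/
noncomputable def linSysPts (K : Type*) [Field K] (D : Finset (ℕ × ℕ)) {r : ℕ}
    (m : Fin r → ℕ) (p : Fin r → K × K) : Submodule K (MvPolynomial (Fin 2) K) :=
  monoSpan K D ⊓ ⨅ j : Fin r, ⨅ β : ℕ × ℕ, ⨅ _ : β.1 + β.2 < m j,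
    LinearMap.ker (evalPt K (p j) ∘ₗ derivOp K β)

/-- `dim L_D(m₁,…,m_r)`: the minimum over all tuples of points of `dim_K L − 1`. -/
noncomputable def dimSys (K : Type*) [Field K] (D : Finset (ℕ × ℕ)) {r : ℕ}
    (m : Fin r → ℕ) : ℤ :=
  sInf (Set.range fun p : Fin r → K × K =>
    (Module.finrank K ↥(linSysPts K D m p) : ℤ) - 1)

/-- The virtual dimension `vdim = #D − 1 − Σ_j C(m_j + 1, 2)`. -/
def vdimSys (D : Finset (ℕ × ℕ)) {r : ℕ} (m : Fin r → ℕ) : ℤ :=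
  (D.card : ℤ) - 1 - ∑ j : Fin r, (((m j + 1).choose 2 : ℕ) : ℤ)

/-- A system is non-special if its dimension equals the expected dimension
`edim = max (vdim, −1)`. -/
def nonSpecial (K : Type*) [Field K] (D : Finset (ℕ × ℕ)) {r : ℕ}
    (m : Fin r → ℕ) : Prop :=
  dimSys K D m = max (vdimSys D m) (-1)

noncomputable def shp {K : Type*} [Field K] (p : Fin 2 → K) :
    MvPolynomial (Fin 2) K →ₐ[K] MvPolynomial (Fin 2) K :=
  aeval (fun i => X i + C (p i))

noncomputable def ordp {K : Type*} [Field K] (p : Fin 2 → K) (g : MvPolynomial (Fin 2) K) : ℕ∞ :=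
  MvPowerSeries.order ((shp p g : MvPolynomial (Fin 2) K) : MvPowerSeries (Fin 2) K)

theorem le_ordp_iff {K : Type*} [Field K] (p : Fin 2 → K) (g : MvPolynomial (Fin 2) K) (n : ℕ) :
    (n : ℕ∞) ≤ ordp p g ↔ shp p g ∈ idealOfVars (Fin 2) K ^ n := by
  rw [mem_pow_idealOfVars_iff']
  constructor
  · intro h d hd
    have := MvPowerSeries.coeff_of_lt_order (f := ((shp p g : MvPolynomial (Fin 2) K) :
      MvPowerSeries (Fin 2) K)) (d := d) (lt_of_lt_of_le (by exact_mod_cast hd) h)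
    simpa using this
  · intro h
    apply MvPowerSeries.nat_le_order
    intro d hd
    simpa using h d hd

theorem ordp_mul {K : Type*} [Field K] (p : Fin 2 → K) (f g : MvPolynomial (Fin 2) K) :
    ordp p (f * g) = ordp p f + ordp p g := by
  simp [ordp, MvPowerSeries.order_mul]

theorem ordp_eq_zero {K : Type*} [Field K] (p : Fin 2 → K) (f : MvPolynomial (Fin 2) K)
    (h : eval p f ≠ 0) : ordp p f = 0 := by
  by_contra h0
  have : ((1 : ℕ) : ℕ∞) ≤ ordp p f := by
    simpa using Order.one_le_iff_ne_zero.2 h0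
  rw [le_ordp_iff, mem_pow_idealOfVars_iff'] at this
  have h1 := this 0 (by simp)
  apply h
  have h2 : (eval (0 : Fin 2 → K)) (shp p f) = eval p f := by
    rw [shp, ← coe_aeval_eq_eval, RingHom.coe_coe, ← AlgHom.comp_apply, comp_aeval,
      ← coe_aeval_eq_eval, RingHom.coe_coe]
    congr 2
    funext i
    simp
  rw [← h2, ← h1, eval_zero, constantCoeff_eq]

theorem ordp_lin {K : Type*} [Field K] [DecidableEq K] (p : Fin 2 → K) (i : Fin 2) (c : K) :
    ordp p (X i - C c) = if p i = c then 1 else 0 := by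
  split_ifs with h
  · subst h
    have : shp p (X i - C (p i)) = X i := by simp [shp]
    rw [ordp, this, X, coe_monomial, MvPowerSeries.order_monomial_of_ne_zero one_ne_zero]
    simp
  · apply ordp_eq_zero
    simpa [sub_eq_zero] using h

theorem ordp_prod {K : Type*} [Field K] [DecidableEq K] (p : Fin 2 → K) (i : Fin 2) (S : Finset K) :
    ordp p (∏ c ∈ S, (X i - C c)) = if p i ∈ S then 1 else 0 := by
  classical
  have : ordp p (∏ c ∈ S, (X i - C c)) = ∑ c ∈ S, ordp p (X i - C c) := by
    induction S using Finset.induction_on with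
    | empty => 
      simp only [Finset.prod_empty, Finset.sum_empty]
      exact ordp_eq_zero _ _ (by simp)
    | insert a s ha ih => rw [Finset.prod_insert ha, Finset.sum_insert ha, ordp_mul, ih]
  rw [this]
  simp [ordp_lin]

theorem lin_ne {K : Type*} [Field K] (i : Fin 2) (c : K) :
    (X i - C c : MvPolynomial (Fin 2) K) ≠ 0 := by
  intro h
  have := congrArg (eval (fun _ => c + 1)) h
  simp at this

theorem degreeOf_lin {K : Type*} [Field K] (i : Fin 2) (c : K) :
    1 ≤ degreeOf i (X i - C c : MvPolynomial (Fin 2) K) := by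
  have : coeff (Finsupp.single i 1) (X i - C c : MvPolynomial (Fin 2) K) ≠ 0 := by
    have h0 : (0 : Fin 2 →₀ ℕ) ≠ Finsupp.single i 1 := by
      intro h
      have := DFunLike.congr_fun h i
      simp at this
    rw [coeff_sub, coeff_C, if_neg h0, X, coeff_monomial, if_pos rfl]
    simp
  have := monomial_le_degreeOf i (mem_support_iff.2 this)
  simpa using this

theorem prod_lin_dvd {K : Type*} [Field K] (i : Fin 2) (S : Finset K)
    (g : MvPolynomial (Fin 2) K) (h : ∀ c ∈ S, (X i - C c) ∣ g) :
    (∏ c ∈ S, (X i - C c)) ∣ g := by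
  apply Finset.prod_dvd_of_coprime _ h
  intro a _ b _ hab
  have := Polynomial.isCoprime_X_sub_C_of_isUnit_sub (sub_ne_zero_of_ne hab).isUnit
  have := this.map (Polynomial.aeval (X i : MvPolynomial (Fin 2) K)).toRingHom
  simpa [Function.onFun, ← MvPolynomial.algebraMap_eq] using this

/-- division by product of lines -/
theorem div_lines {K : Type*} [Field K] (i j : Fin 2) (S : Finset K)
    (g : MvPolynomial (Fin 2) K) (hg : g ≠ 0) (h : ∀ c ∈ S, (X i - C c) ∣ g) :
    ∃ f : MvPolynomial (Fin 2) K, f ≠ 0 ∧ degreeOf i f + S.card ≤ degreeOf i g ∧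
      degreeOf j f ≤ degreeOf j g ∧
      ∀ p : Fin 2 → K, p i ∈ S → ∀ n : ℕ, ((n + 1 : ℕ) : ℕ∞) ≤ ordp p g → (n : ℕ∞) ≤ ordp p f := by
  classical
  obtain ⟨f, rfl⟩ := prod_lin_dvd i S g h
  have hf : f ≠ 0 := right_ne_zero_of_mul hg
  have hA : (∏ c ∈ S, (X i - C c : MvPolynomial (Fin 2) K)) ≠ 0 := left_ne_zero_of_mul hg
  refine ⟨f, hf, ?_, ?_, ?_⟩
  · rw [degreeOf_mul_eq hA hf, degreeOf_prod_eq _ _ (fun c _ => lin_ne i c)]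
    have : S.card ≤ ∑ c ∈ S, degreeOf i (X i - C c : MvPolynomial (Fin 2) K) := by
      rw [Finset.card_eq_sum_ones]
      exact Finset.sum_le_sum (fun c _ => degreeOf_lin i c)
    omega
  · rw [degreeOf_mul_eq hA hf]
    omega
  · intro p hp n hn
    rw [ordp_mul, ordp_prod, if_pos hp, Nat.cast_add, Nat.cast_one, add_comm (n : ℕ∞) 1] at hn
    exact (ENat.add_le_add_iff_left ENat.one_ne_top).1 hn

theorem line_dvd {K : Type*} [Field K] (i j : Fin 2) (hij : i ≠ j) (S : Finset K) (c : K) (n : ℕ)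
    (g : MvPolynomial (Fin 2) K) (hdeg : degreeOf i g < n * S.card)
    (h : ∀ a ∈ S, ∀ p : Fin 2 → K, p i = a → p j = c → (n : ℕ∞) ≤ ordp p g) :
    (X j - C c) ∣ g := by
  set v : Fin 2 → Polynomial K := fun l => if l = i then Polynomial.X else Polynomial.C c with hv
  have hP : aeval v g = 0 := by
    by_contra hne
    have hd : ∀ a ∈ S, (Polynomial.X - Polynomial.C a) ^ n ∣ aeval v g := by
      intro a ha
      have h1 := h a ha (fun l => if l = i then a else c) (by simp) (by simp [hij.symm])
      rw [le_ordp_iff] at h1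
      set w : Fin 2 → Polynomial K := fun l => if l = i then Polynomial.X - Polynomial.C a else 0
      have h2 := Ideal.mem_map_of_mem (aeval w : MvPolynomial (Fin 2) K →ₐ[K] Polynomial K) h1
      rw [Ideal.map_pow] at h2
      have h3 : Ideal.map (aeval w : MvPolynomial (Fin 2) K →ₐ[K] Polynomial K)
          (idealOfVars (Fin 2) K) ≤ Ideal.span {Polynomial.X - Polynomial.C a} := by
        rw [idealOfVars, Ideal.map_span, Ideal.span_le]
        rintro _ ⟨_, ⟨l, rfl⟩, rfl⟩
        simp only [aeval_X, w, SetLike.mem_coe, Ideal.mem_span_singleton]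
        split_ifs <;> simp
      have h4 := Ideal.pow_right_mono h3 n h2
      rw [Ideal.span_singleton_pow, Ideal.mem_span_singleton] at h4
      convert h4 using 1
      rw [shp, ← AlgHom.comp_apply, comp_aeval]
      congr 2
      funext l
      by_cases hl : l = i
      · simp [hv, w, hl, ← Polynomial.algebraMap_eq]
      · simp [hv, w, hl, ← Polynomial.algebraMap_eq]
    have hprod : (∏ a ∈ S, (Polynomial.X - Polynomial.C a) ^ n) ∣ aeval v g := by
      apply Finset.prod_dvd_of_coprime _ hd
      intro a _ b _ hab
      exact (Polynomial.isCoprime_X_sub_C_of_isUnit_sub (sub_ne_zero_of_ne hab).isUnit).pow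
    have h5 := Polynomial.natDegree_le_of_dvd hprod hne
    rw [Polynomial.natDegree_prod_of_monic _ _ (fun a _ => (Polynomial.monic_X_sub_C a).pow n)] at h5
    simp only [Polynomial.natDegree_pow, Polynomial.natDegree_X_sub_C, mul_one, Finset.sum_const,
      smul_eq_mul] at h5
    have h6 : (aeval v g).natDegree ≤ degreeOf i g := by
      rw [aeval_def, eval₂_eq]
      apply Polynomial.natDegree_sum_le_of_forall_le
      intro d hd
      have h7 := monomial_le_degreeOf i hd
      refine le_trans ?_ h7
      rw [Polynomial.algebraMap_eq]
      refine (Polynomial.natDegree_C_mul_le _ _).trans ?_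
      refine (Polynomial.natDegree_prod_le _ _).trans ?_
      have : ∀ l : Fin 2, (v l ^ d l).natDegree ≤ if l = i then d l else 0 := by
        intro l
        by_cases hl : l = i
        · simp [hv, hl]
        · simp only [hv, hl, if_false, ← Polynomial.C_pow, Polynomial.natDegree_C, le_refl]
      refine (Finset.sum_le_sum (fun l _ => this l)).trans ?_
      rw [Finset.sum_ite_eq']
      split_ifs <;> simp
    rw [mul_comm] at h5
    omega
  -- conclude
  rw [← Ideal.mem_span_singleton, ← Ideal.Quotient.eq_zero_iff_mem]
  set I : Ideal (MvPolynomial (Fin 2) K) := Ideal.span {X j - C c}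
  set e : Polynomial K →ₐ[K] (MvPolynomial (Fin 2) K ⧸ I) :=
    Polynomial.aeval (Ideal.Quotient.mkₐ K I (X i)) with he
  have h8 : e.comp (aeval v) = Ideal.Quotient.mkₐ K I := by
    apply MvPolynomial.algHom_ext
    intro l
    by_cases hl : l = i
    · simp [hv, hl, he]
    · have hl' : l = j := by omega
      subst hl'
      simp only [AlgHom.comp_apply, aeval_X, hv, if_neg hl, he, Polynomial.aeval_C]
      have : Ideal.Quotient.mkₐ K I (X l - C c) = 0 := by
        rw [Ideal.Quotient.mkₐ_eq_mk, Ideal.Quotient.eq_zero_iff_mem]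
        exact Ideal.subset_span rfl
      rw [map_sub, sub_eq_zero] at this
      rw [this, ← MvPolynomial.algebraMap_eq, AlgHom.commutes]
  have := DFunLike.congr_fun h8 g
  rw [AlgHom.comp_apply, hP, map_zero] at this
  simpa using this.symm

theorem core {K : Type*} [Field K] (S T : Finset K) (c e : K) (hce : c ≠ e) (q : ℕ)
    (hS : S.card = q) (hT : T.card = q) (hST : Disjoint S T) (m : ℕ) :
    ∀ g : MvPolynomial (Fin 2) K, degreeOf 0 g < (m + 1) * q → degreeOf 1 g < m →
    (∀ p : Fin 2 → K, (p 0 ∈ S ∧ p 1 = c) ∨ (p 0 ∈ T ∧ p 1 = e) → (m : ℕ∞) ≤ ordp p g) →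
    g = 0 := by
  classical
  induction m using Nat.strong_induction_on with
  | _ m ih =>
  intro g h0 h1 hp
  by_contra hg
  obtain ⟨n, rfl⟩ : ∃ n, m = n + 1 := ⟨m - 1, by omega⟩
  have hdv : ∀ a ∈ S ∪ T, (X 0 - C a) ∣ g := by
    intro a ha
    rw [Finset.mem_union] at ha
    rcases ha with ha | ha
    · apply line_dvd 1 0 (by decide) {c} a (n + 1) g (by simpa using h1)
      intro b hb p hp1 hp0
      apply hp
      left
      exact ⟨hp0 ▸ ha, by rw [hp1]; simpa using hb⟩
    · apply line_dvd 1 0 (by decide) {e} a (n + 1) g (by simpa using h1)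
      intro b hb p hp1 hp0
      apply hp
      right
      exact ⟨hp0 ▸ ha, by rw [hp1]; simpa using hb⟩
  obtain ⟨f, hf, hf0, hf1, hfo⟩ := div_lines 0 1 (S ∪ T) g hg hdv
  rw [Finset.card_union_of_disjoint hST, hS, hT] at hf0
  have hf0' : degreeOf 0 f < n * q := by
    have : (n + 1 + 1) * q = n * q + (q + q) := by ring
    omega
  have hfp : ∀ p : Fin 2 → K, (p 0 ∈ S ∧ p 1 = c) ∨ (p 0 ∈ T ∧ p 1 = e) → (n : ℕ∞) ≤ ordp p f := by
    intro p h
    apply hfo p _ n (hp p h)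
    rw [Finset.mem_union]
    tauto
  obtain ⟨l, rfl⟩ : ∃ l, n = l + 1 := by
    refine ⟨n - 1, ?_⟩
    rcases Nat.eq_zero_or_pos n with h | h
    · subst h; simp at hf0'
    · omega
  have hdv2 : ∀ a ∈ ({c, e} : Finset K), (X 1 - C a) ∣ f := by
    intro a ha
    rw [Finset.mem_insert, Finset.mem_singleton] at ha
    rcases ha with rfl | rfl
    · apply line_dvd 0 1 (by decide) S a (l + 1) f (by rwa [hS])
      intro b hb p hp0 hp1
      exact hfp p (Or.inl ⟨hp0 ▸ hb, hp1⟩)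
    · apply line_dvd 0 1 (by decide) T a (l + 1) f (by rwa [hT])
      intro b hb p hp0 hp1
      exact hfp p (Or.inr ⟨hp0 ▸ hb, hp1⟩)
  obtain ⟨r, hr, hr1, hr0, hro⟩ := div_lines 1 0 {c, e} f hf hdv2
  rw [Finset.card_pair hce] at hr1
  apply hr
  apply ih l (by omega) r (by omega) (by omega)
  intro p h
  apply hro p _ l (hfp p h)
  rw [Finset.mem_insert, Finset.mem_singleton]
  tauto

theorem shp_pderiv {K : Type*} [Field K] (p : Fin 2 → K) (i : Fin 2) (f : MvPolynomial (Fin 2) K) :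
    shp p (pderiv i f) = pderiv i (shp p f) := by
  induction f using MvPolynomial.induction_on with
  | C a => simp [shp, ← MvPolynomial.algebraMap_eq]
  | add f g hf hg => simp [hf, hg]
  | mul_X f j hf =>
    have hX : shp p (X j) = X j + C (p j) := by simp [shp]
    rw [pderiv_mul, map_mul, pderiv_mul, map_add, map_mul, map_mul, hf, hX, map_add, pderiv_C,
      add_zero, pderiv_X]
    congr 2
    by_cases h : j = i
    · subst h; simp
    · simp [h]

theorem coeff_iter {K : Type*} [Field K] [CharZero K] (i : Fin 2) (n : ℕ) :
    ∀ (d : Fin 2 →₀ ℕ) (F : MvPolynomial (Fin 2) K),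
      coeff d (((pderiv i).toLinearMap ^ n : Module.End K (MvPolynomial (Fin 2) K)) F) = 0 ↔
      coeff (d + Finsupp.single i n) F = 0 := by
  induction n with
  | zero => intro d F; simp
  | succ n ih =>
    intro d F
    rw [pow_succ, Module.End.mul_apply, ih, Derivation.coeFn_coe,
      coeff_pderiv, add_assoc, ← Finsupp.single_add]
    have : (((d + Finsupp.single i n) i : ℕ) : K) + 1 ≠ 0 := Nat.cast_add_one_ne_zero _
    rw [mul_eq_zero, or_iff_left this]

theorem ordp_of_deriv {K : Type*} [Field K] [CharZero K] (p : K × K) (m : ℕ)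
    (f : MvPolynomial (Fin 2) K)
    (h : ∀ β : ℕ × ℕ, β.1 + β.2 < m → evalPt K p (derivOp K β f) = 0) :
    (m : ℕ∞) ≤ ordp (fun i => if i = 0 then p.1 else p.2) f := by
  rw [le_ordp_iff, mem_pow_idealOfVars_iff']
  intro d hd
  have h1 := h (d 0, d 1) (by simpa [Finsupp.degree_eq_sum] using hd)
  set P : Fin 2 → K := fun i => if i = 0 then p.1 else p.2 with hP
  have h2 : ∀ F, evalPt K p F = coeff 0 (shp P F) := by
    intro F
    rw [← constantCoeff_eq]
    have : (evalPt K p) F = aeval P F := rfl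
    rw [this]
    have h3 : (aeval P : MvPolynomial (Fin 2) K →ₐ[K] K) =
        (aeval (0 : Fin 2 → K)).comp (shp P) := by
      apply MvPolynomial.algHom_ext
      intro i
      simp [shp]
    rw [h3, AlgHom.comp_apply]
    simp [MvPolynomial.aeval_zero]
  have h4 : ∀ i n F, shp P (((pderiv i).toLinearMap ^ n : Module.End K (MvPolynomial (Fin 2) K)) F)
      = ((pderiv i).toLinearMap ^ n : Module.End K (MvPolynomial (Fin 2) K)) (shp P F) := by
    intro i n
    induction n with
    | zero => intro F; simp
    | succ n ih =>
      intro F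
      rw [pow_succ, Module.End.mul_apply, ih, Module.End.mul_apply]
      simp [shp_pderiv]
  rw [h2, derivOp, Module.End.mul_apply, h4, h4, coeff_iter, coeff_iter] at h1
  convert h1 using 2
  ext i
  fin_cases i <;> simp

noncomputable def phi (K : Type*) [Field K] : MvPolynomial (Fin 2) K →ₐ[K] MvPolynomial (Fin 2) K :=
  aeval (fun i => if i = 0 then X 0 * X 1 else X 1)

theorem phi_inj {K : Type*} [Field K] (f : MvPolynomial (Fin 2) K) (h : phi K f = 0) : f = 0 := by
  set x : Fin 2 → FractionRing (MvPolynomial (Fin 2) K) := fun i => algebraMap (MvPolynomial (Fin 2) K) _ (X i) with hx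
  have hne : x 1 ≠ 0 := by
    rw [hx]
    simp
  have : (aeval (fun i : Fin 2 => if i = 0 then x 0 / x 1 else x 1)).comp (phi K) =
      IsScalarTower.toAlgHom K (MvPolynomial (Fin 2) K) (FractionRing (MvPolynomial (Fin 2) K)) := by
    apply MvPolynomial.algHom_ext
    intro i
    fin_cases i
    · simp [phi, hne]; rfl
    · simp [phi]; rfl
  have h1 := DFunLike.congr_fun this f
  rw [AlgHom.comp_apply, h, map_zero] at h1
  exact IsFractionRing.injective (MvPolynomial (Fin 2) K) (FractionRing (MvPolynomial (Fin 2) K))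
    (by simpa using h1.symm)

theorem ordp_phi {K : Type*} [Field K] (p p' : Fin 2 → K) (h0 : p' 0 = p 0 * p 1) (h1 : p' 1 = p 1)
    (m : ℕ) (f : MvPolynomial (Fin 2) K) (h : (m : ℕ∞) ≤ ordp p' f) : (m : ℕ∞) ≤ ordp p (phi K f) := by
  rw [le_ordp_iff] at h ⊢
  set ψ : MvPolynomial (Fin 2) K →ₐ[K] MvPolynomial (Fin 2) K :=
    aeval (fun i => if i = 0 then X 0 * X 1 + C (p 0) * X 1 + C (p 1) * X 0 else X 1) with hψ
  have e : (shp p).comp (phi K) = ψ.comp (shp p') := by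
    apply MvPolynomial.algHom_ext
    intro i
    fin_cases i
    · simp [phi, shp, hψ, h0, algHom_C]
      ring
    · simp [phi, shp, hψ, h1, ← MvPolynomial.algebraMap_eq]
  have e1 := DFunLike.congr_fun e f
  rw [AlgHom.comp_apply, AlgHom.comp_apply] at e1
  rw [e1]
  have h2 := Ideal.mem_map_of_mem ψ h
  rw [Ideal.map_pow] at h2
  refine Ideal.pow_right_mono ?_ m h2
  have hX : ∀ i, (X i : MvPolynomial (Fin 2) K) ∈ idealOfVars (Fin 2) K :=
    fun i => Ideal.subset_span ⟨i, rfl⟩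
  rw [idealOfVars, Ideal.map_span, Ideal.span_le]
  rintro _ ⟨_, ⟨l, rfl⟩, rfl⟩
  rw [hψ, aeval_X]
  split_ifs
  · exact add_mem (add_mem (Ideal.mul_mem_left _ _ (hX 1)) (Ideal.mul_mem_left _ _ (hX 1)))
      (Ideal.mul_mem_left _ _ (hX 0))
  · exact hX 1

theorem phi_form {K : Type*} [Field K] (m k : ℕ) (hm : 0 < m) (hk : 0 < k)
    (f : MvPolynomial (Fin 2) K)
    (hf : f ∈ monoSpan K ((Finset.range k ×ˢ Finset.range (k + m)).filter
          fun d => k - 1 ≤ d.1 + d.2 ∧ d.1 + d.2 ≤ k + m - 2)) :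
    ∃ g : MvPolynomial (Fin 2) K, phi K f = X 1 ^ (k - 1) * g ∧ degreeOf 0 g < k ∧
      degreeOf 1 g < m := by
  induction hf using Submodule.span_induction with
  | mem x hx =>
    obtain ⟨⟨i, j⟩, hd, rfl⟩ := hx
    simp only [Finset.coe_filter, Finset.mem_product, Finset.mem_range, Set.mem_ofPred_eq] at hd
    obtain ⟨s, hs⟩ : ∃ s, i + j = k - 1 + s := ⟨i + j - (k - 1), by omega⟩
    refine ⟨monomial (Finsupp.single 0 i + Finsupp.single 1 s) 1, ?_, ?_, ?_⟩
    · beta_reduce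
      rw [← one_mul (1 : K), ← monomial_mul, ← monomial_mul]
      simp only [← X_pow_eq_monomial]
      simp only [phi, map_mul, map_pow, aeval_X]
      simp only [if_true, one_ne_zero, if_false]
      rw [mul_pow, mul_assoc, ← pow_add, hs, pow_add]
      ring
    · rw [degreeOf_monomial_eq _ _ one_ne_zero]
      simp; omega
    · rw [degreeOf_monomial_eq _ _ one_ne_zero]
      simp; omega
  | zero => exact ⟨0, by simp, by simpa, by simpa⟩
  | add x y _ _ hx hy =>
    obtain ⟨g, hg, hg0, hg1⟩ := hx
    obtain ⟨g', hg', hg0', hg1'⟩ := hy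
    exact ⟨g + g', by rw [map_add, hg, hg']; ring,
      (degreeOf_add_le _ _ _).trans_lt (max_lt hg0 hg0'),
      (degreeOf_add_le _ _ _).trans_lt (max_lt hg1 hg1')⟩
  | smul a x _ hx =>
    obtain ⟨g, hg, hg0, hg1⟩ := hx
    exact ⟨C a * g, by rw [map_smul, hg, smul_eq_C_mul]; ring,
      (degreeOf_C_mul_le _ _ _).trans_lt hg0, (degreeOf_C_mul_le _ _ _).trans_lt hg1⟩

theorem card_D (m k : ℕ) (hm : 0 < m) :
    ((Finset.range k ×ˢ Finset.range (k + m)).filter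
          fun d : ℕ × ℕ => k - 1 ≤ d.1 + d.2 ∧ d.1 + d.2 ≤ k + m - 2).card = k * m := by
  have : k * m = (Finset.range k ×ˢ Finset.range m).card := by simp
  rw [this]
  refine Finset.card_nbij' (fun d => (d.1, d.1 + d.2 - (k - 1))) (fun d => (d.1, k - 1 + d.2 - d.1))
    ?_ ?_ ?_ ?_
  · rintro ⟨i, j⟩ h
    simp at h ⊢
    omega
  · rintro ⟨i, j⟩ h
    simp at h ⊢
    omega
  · rintro ⟨i, j⟩ h
    simp at h ⊢
    omega
  · rintro ⟨i, j⟩ h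
    simp at h ⊢
    omega

theorem exists_pts {K : Type*} [Field K] [CharZero K] (m q : ℕ) (hm : 0 < m) (hk : 0 < (m + 1) * q) :
    ∃ p : Fin (2 * q) → K × K, linSysPts K
      ((Finset.range ((m + 1) * q) ×ˢ Finset.range ((m + 1) * q + m)).filter
          fun d => (m + 1) * q - 1 ≤ d.1 + d.2 ∧ d.1 + d.2 ≤ (m + 1) * q + m - 2)
      (fun _ => m) p = ⊥ := by
  classical
  refine ⟨fun j => if (j : ℕ) < q then ((j : ℕ) * 1, 1) else ((j : ℕ) * 2, 2), ?_⟩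
  rw [eq_bot_iff]
  intro f hf
  rw [linSysPts, Submodule.mem_inf] at hf
  obtain ⟨hD, hv⟩ := hf
  simp only [Submodule.mem_iInf, LinearMap.mem_ker, LinearMap.comp_apply] at hv
  obtain ⟨g, hg, hg0, hg1⟩ := phi_form m _ hm hk f hD
  rw [Submodule.mem_bot]
  apply phi_inj
  rw [hg]
  have hgz : g = 0 := by
    apply core ((Finset.range q).image (fun n : ℕ => (n : K)))
      ((Finset.Ico q (2 * q)).image (fun n : ℕ => (n : K))) 1 2 (by norm_num) q
      (by rw [Finset.card_image_of_injective _ Nat.cast_injective]; simp)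
      (by rw [Finset.card_image_of_injective _ Nat.cast_injective]; simp; omega)
      ?_ m g hg0 hg1 ?_
    · rw [Finset.disjoint_image Nat.cast_injective, Finset.disjoint_left]
      intro a ha hb
      simp at ha hb
      omega
    · intro p hp
      have key : ∃ j : Fin (2 * q), (if (j : ℕ) < q then (((j : ℕ) : K) * 1, (1 : K))
          else (((j : ℕ) : K) * 2, 2)) = (p 0 * p 1, p 1) ∧ p 1 ≠ 0 := by
        rcases hp with ⟨h0, h1⟩ | ⟨h0, h1⟩
        · obtain ⟨n, hn, hn'⟩ := Finset.mem_image.1 h0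
          rw [Finset.mem_range] at hn
          exact ⟨⟨n, by omega⟩, by simp [hn, h1, ← hn'], by simp [h1]⟩
        · obtain ⟨n, hn, hn'⟩ := Finset.mem_image.1 h0
          rw [Finset.mem_Ico] at hn
          exact ⟨⟨n, by omega⟩, by simp [hn.1.not_gt, h1, ← hn'], by simp [h1]⟩
      obtain ⟨j, hj, hne⟩ := key
      have h1 := ordp_of_deriv _ m f (hv j)
      rw [hj] at h1
      have h2 := ordp_phi p _ (by simp) (by simp) m f h1
      rw [hg, ordp_mul, ordp_eq_zero p (X 1 ^ ((m + 1) * q - 1)) (by simp [hne]), zero_add] at h2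
      exact h2
  rw [hgz, mul_zero]

/-- Let `m, k ≥ 1` with `(m+1) ∣ k`, and
`D = (m^{↑k−1}, m^{↑k−2}, …, m^{↑0}) = {(i,j) : i ≤ k−1, k−1−i ≤ j ≤ k+m−2−i}`.
Then `L = L_D(m^{×2k/(m+1)})` is non-special and `vdim L = −1`. -/
theorem statement9 {K : Type*} [Field K] [CharZero K]
    (m k : ℕ) (hm : 0 < m) (hk : 0 < k) (hdvd : (m + 1) ∣ k) :
    nonSpecial K
        ((Finset.range k ×ˢ Finset.range (k + m)).filter
          fun d => k - 1 ≤ d.1 + d.2 ∧ d.1 + d.2 ≤ k + m - 2)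
        (fun _ : Fin (2 * (k / (m + 1))) => m) ∧
      vdimSys ((Finset.range k ×ˢ Finset.range (k + m)).filter
          fun d => k - 1 ≤ d.1 + d.2 ∧ d.1 + d.2 ≤ k + m - 2)
        (fun _ : Fin (2 * (k / (m + 1))) => m) = -1 := by
  obtain ⟨q, rfl⟩ := hdvd
  rw [Nat.mul_div_cancel_left q (Nat.succ_pos m)]
  have hv : vdimSys ((Finset.range ((m + 1) * q) ×ˢ Finset.range ((m + 1) * q + m)).filter
          fun d => (m + 1) * q - 1 ≤ d.1 + d.2 ∧ d.1 + d.2 ≤ (m + 1) * q + m - 2)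
        (fun _ : Fin (2 * q) => m) = -1 := by
    rw [vdimSys, card_D _ _ hm]
    have h2 : (m + 1).choose 2 * 2 = (m + 1) * m := by
      rw [Nat.choose_two_right, Nat.add_sub_cancel]
      exact Nat.div_mul_cancel (by simpa [mul_comm] using (Nat.even_mul_succ_self m).two_dvd)
    have h3 : (((m + 1).choose 2 : ℕ) : ℤ) * 2 = (m + 1) * m := by exact_mod_cast h2
    simp only [Finset.sum_const, Finset.card_univ, Fintype.card_fin, nsmul_eq_mul]
    push_cast
    linear_combination (-(q : ℤ)) * h3
  refine ⟨?_, hv⟩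
  rw [nonSpecial, hv, max_self, dimSys]
  obtain ⟨p, hp⟩ := exists_pts (K := K) m q hm hk
  apply IsLeast.csInf_eq
  refine ⟨⟨p, ?_⟩, ?_⟩
  · beta_reduce
    rw [hp]
    simp
  · rintro _ ⟨p', rfl⟩
    beta_reduce
    omega
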